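/- For every h∈ℕ and every s∈ℕ there exist finite ordered sets P1 and P2 such that: P1 and P2 are not order-isomorphic; P1 and P2 have height at least h; for every rank k ∉ {1,2}, P1 and P2 have equal marked rank k decks; every rank of P1 and of P2 contains at least s elements; and even for each of the ranks 1 and 2 there are at least s elements x of that rank in P1 and correspondingly many elements in P2 whose removal produces order-isomorphic cards of P1 and P2. -/

import Mathlib

/-- A finite ordered set: a type equipped with a partial order and a `Fintype` structure. -/
structure FinPoset where
  carrier : Type
  [po : PartialOrder carrier]
  [ft : Fintype carrier]

instance : CoeSort FinPoset Type := ⟨FinPoset.carrier⟩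
attribute [instance] FinPoset.po FinPoset.ft

/-- The card of an ordered set obtained by deleting the point `x`,
as an induced subposet. -/
abbrev Card (P : Type*) [PartialOrder P] (x : P) : Type _ := {y : P // y ≠ x}

/-- `P` and `P'` have equal marked rank `k` decks: a bijection `σ` between the rank-`k`
elements such that each card `P∖{x}` is isomorphic to `P'∖{σ x}` via a rank-preserving
order isomorphism.  (The rank of an element is `Order.height`.) -/
def EqualMarkedRankDecks (P P' : Type*) [PartialOrder P] [PartialOrder P'] (k : ℕ) : Prop :=
  ∃ σ : {x : P // Order.height x = (k : ℕ∞)} ≃ {y : P' // Order.height y = (k : ℕ∞)},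
    ∀ x : {x : P // Order.height x = (k : ℕ∞)},
      ∃ Φ : Card P x.val ≃o Card P' (σ x).val,
        ∀ z : Card P x.val, Order.height (Φ z).val = Order.height z.val

/-- The height of an ordered set: the maximum rank of its elements. -/
noncomputable def posetHeight (P : Type*) [PartialOrder P] : ℕ∞ :=
  ⨆ x : P, Order.height x

theorem Fin.eq_id_of_monotone_of_injective {n : ℕ} {f : Fin n → Fin n} (hf : Monotone f)
    (hinj : Function.Injective f) : f = id :=
  ((hf.strictMono_of_injective hinj).range_inj strictMono_id).1 <| by
    rw [(Finite.injective_iff_surjective.1 hinj).range_eq, Set.range_id]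

/-- If `rk` is strictly monotone and every point of positive `rk` has a point of `rk` one less
below it, then `rk` is the rank function. -/
theorem height_eq_of_strictMono_of_pred {α : Type*} [Preorder α] (rk : α → ℕ)
    (hmono : StrictMono rk) (hpred : ∀ x n, rk x = n + 1 → ∃ y < x, rk y = n) (x : α) :
    Order.height x = rk x := by
  apply le_antisymm
  · simpa using Order.height_le_height_apply_of_strictMono rk hmono x
  · obtain ⟨n, hn⟩ : ∃ n, rk x = n := ⟨_, rfl⟩
    induction n generalizing x with
    | zero => simp [hn]
    | succ n ih =>
      obtain ⟨y, hy, hyn⟩ := hpred x n hn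
      have h1 := ih y hyn
      rw [hyn] at h1
      rw [hn]
      calc ((n + 1 : ℕ) : ℕ∞) = n + 1 := by push_cast; rfl
        _ ≤ Order.height y + 1 := by gcongr
        _ ≤ Order.height x := Order.height_add_one_le hy

/-- The points of the ambient ordered set: *markers* `k d` of rank `d / S`, a grid `c ρ i` of rank
one, *rows* `y ρ` of rank two, *states* `t π` of rank two, and two auxiliary points `u`, `v` of rank
one. -/
inductive Pt (S N : ℕ) : Type
  | k (d : Fin N)
  | c (ρ i : Fin (N + 1))
  | y (ρ : Fin (N + 1))
  | t (π : Equiv.Perm (Fin (N + 1)))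
  | u
  | v

namespace Pt

variable {S N : ℕ}

/-- The rank of a point. -/
def rk : Pt S N → ℕ
  | k d => d / S
  | c _ _ => 1
  | y _ => 2
  | t _ => 2
  | u => 1
  | v => 1

/-- The strict order. The marker `k d` separates the rows `ρ ≤ d` from the rows `ρ > d`. -/
def Below : Pt S N → Pt S N → Prop
  | k d, k e => (d : ℕ) / S < e / S ∧ (d : ℕ) / S ≠ 2 ∧ ((d : ℕ) / S = 1 → (e : ℕ) / S ≠ 2)
  | k d, c ρ _ => (d : ℕ) / S = 0 ∧ ((d : ℕ) = 0 ↔ ¬ (ρ : ℕ) ≤ d)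
  | k d, y ρ => (d : ℕ) / S = 0 ∨ (d : ℕ) / S = 1 ∧ (ρ : ℕ) ≤ d
  | k d, t _ => (d : ℕ) / S = 0
  | k d, u => (d : ℕ) = 0
  | k d, v => (d : ℕ) / S = 0
  | c ρ _, k d => (d : ℕ) / S = 2 ∧ (ρ : ℕ) ≤ d ∨ 3 ≤ (d : ℕ) / S
  | c ρ _, y ρ' => ρ ≠ ρ'
  | c ρ i, t π => i ≤ π ρ
  | y ρ, k d => 3 ≤ (d : ℕ) / S ∧ (ρ : ℕ) ≤ d
  | u, t _ => True
  | v, t _ => True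
  | v, k d => (d : ℕ) / S = 2
  | _, _ => False

theorem Below.rk_lt {p q : Pt S N} (h : Below p q) : rk p < rk q := by
  cases p <;> cases q <;> simp only [Below, rk] at * <;> first | omega | simp_all

theorem Below.trans {p q r : Pt S N} (h : Below p q) (h' : Below q r) : Below p r := by
  have hlt : ∀ {a b : ℕ}, a / S < b / S → a < b := fun h => lt_of_not_ge fun hh =>
    absurd (Nat.div_le_div_right hh) (not_le.2 h)
  cases p <;> cases q <;> simp only [Below] at h <;> cases r <;> simp only [Below] at h' ⊢ <;>
    first
    | omega
    | (have := hlt h'.1; omega)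
    | (have := h.1; omega)
    | (clear hlt; grind)
    | simp_all

instance : PartialOrder (Pt S N) where
  le p q := p = q ∨ Below p q
  le_refl p := Or.inl rfl
  le_trans := by
    rintro p q r (rfl | h) (rfl | h')
    · exact Or.inl rfl
    · exact Or.inr h'
    · exact Or.inr h
    · exact Or.inr (h.trans h')
  le_antisymm := by
    rintro p q (rfl | h) (h' | h')
    · rfl
    · rfl
    · exact h'.symm
    · exact absurd h.rk_lt h'.rk_lt.not_gt

theorem le_def {p q : Pt S N} : p ≤ q ↔ p = q ∨ Below p q := Iff.rfl

theorem lt_iff_below {p q : Pt S N} : p < q ↔ Below p q := by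
  rw [lt_iff_le_and_ne, le_def]
  constructor
  · rintro ⟨rfl | h, h'⟩
    · exact absurd rfl h'
    · exact h
  · intro h
    exact ⟨Or.inr h, fun e => absurd h.rk_lt (by simp [e])⟩

instance : Finite (Pt S N) := by
  let f : Pt S N → Fin N ⊕ (Fin (N + 1) × Fin (N + 1)) ⊕ Fin (N + 1) ⊕
      Equiv.Perm (Fin (N + 1)) ⊕ Bool := fun
    | k d => .inl d
    | c ρ i => .inr (.inl (ρ, i))
    | y ρ => .inr (.inr (.inl ρ))
    | t π => .inr (.inr (.inr (.inl π)))
    | u => .inr (.inr (.inr (.inr true)))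
    | v => .inr (.inr (.inr (.inr false)))
  refine Finite.of_injective f fun p q h => ?_
  cases p <;> cases q <;> simp_all [f]

/-- The action of a permutation of the rows. -/
def moveRows (τ : Equiv.Perm (Fin (N + 1))) : Pt S N → Pt S N
  | k d => k d
  | c ρ i => c (τ ρ) i
  | y ρ => y (τ ρ)
  | t π => t (π * τ⁻¹)
  | u => u
  | v => v

theorem moveRows_moveRows (τ τ' : Equiv.Perm (Fin (N + 1))) (h : τ' * τ = 1) (p : Pt S N) :
    moveRows τ' (moveRows τ p) = p := by
  have h1 (ρ) : τ' (τ ρ) = ρ := by simpa using congrArg (fun f => f ρ) h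
  cases p <;> simp [moveRows, h1, mul_assoc, ← mul_inv_rev, h]

theorem rk_moveRows (τ : Equiv.Perm (Fin (N + 1))) (p : Pt S N) : rk (moveRows τ p) = rk p := by
  cases p <;> rfl

/-- Exchanging rows `d` and `d + 1` is only noticed by the marker `k d`. -/
theorem moveRows_below {d : Fin N} {p q : Pt S N} (hp : p ≠ k d) (hq : q ≠ k d) :
    Below (moveRows (Equiv.swap d.castSucc d.succ) p)
      (moveRows (Equiv.swap d.castSucc d.succ) q) ↔ Below p q := by
  have key : ∀ e : Fin N, e ≠ d → ∀ ρ : Fin (N + 1),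
      ((Equiv.swap d.castSucc d.succ ρ : Fin (N + 1)) : ℕ) ≤ e ↔ (ρ : ℕ) ≤ e := by
    intro e he ρ
    have : (e : ℕ) ≠ d := fun h => he (Fin.ext h)
    rw [Equiv.swap_apply_def]
    split_ifs with h1 h2
    · subst h1; simp only [Fin.val_succ, Fin.val_castSucc]; omega
    · subst h2; simp only [Fin.val_succ, Fin.val_castSucc]; omega
    · rfl
  cases p <;> cases q <;> simp only [moveRows, Below, ne_eq, k.injEq] at * <;>
    first
    | rw [key _ hp]
    | rw [key _ hq]
    | simp

/-- The states of sign `ε` together with all points that are not states. -/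
def HasSign (ε : ℤˣ) : Pt S N → Prop
  | t π => Equiv.Perm.sign π = ε
  | _ => True

@[simp] theorem hasSign_k (ε : ℤˣ) (d : Fin N) : HasSign ε (k d : Pt S N) := trivial

@[simp] theorem hasSign_c (ε : ℤˣ) (ρ i : Fin (N + 1)) : HasSign ε (c ρ i : Pt S N) := trivial

@[simp] theorem hasSign_y (ε : ℤˣ) (ρ : Fin (N + 1)) : HasSign ε (y ρ : Pt S N) := trivial

@[simp] theorem hasSign_t {ε : ℤˣ} {π : Equiv.Perm (Fin (N + 1))} :
    HasSign ε (t π : Pt S N) ↔ Equiv.Perm.sign π = ε := Iff.rfl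

@[simp] theorem hasSign_u (ε : ℤˣ) : HasSign ε (u : Pt S N) := trivial

@[simp] theorem hasSign_v (ε : ℤˣ) : HasSign ε (v : Pt S N) := trivial

theorem HasSign.moveRows {ε : ℤˣ} {τ : Equiv.Perm (Fin (N + 1))} (hτ : Equiv.Perm.sign τ = -1)
    {p : Pt S N} (hp : HasSign ε p) : HasSign (-ε) (moveRows τ p) := by
  cases p <;> simp_all [HasSign, Pt.moveRows]

end Pt

/-- The ordered set whose states are the permutations of sign `ε`. -/
abbrev SignedPoset (S N : ℕ) (ε : ℤˣ) : Type := {p : Pt S N // p.HasSign ε}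

namespace SignedPoset

open Pt

variable {S N : ℕ} {ε : ℤˣ}

theorem lt_iff {p q : SignedPoset S N ε} : p < q ↔ Below p.1 q.1 := by
  rw [← Subtype.coe_lt_coe, lt_iff_below]

theorem exists_perm_apply_eq (hN : 2 ≤ N) (ε : ℤˣ) (ρ i : Fin (N + 1)) :
    ∃ π : Equiv.Perm (Fin (N + 1)), Equiv.Perm.sign π = ε ∧ π ρ = i := by
  by_cases h : Equiv.Perm.sign (Equiv.swap ρ i) = ε
  · exact ⟨_, h, by simp⟩
  · obtain ⟨a, ha, b, hb, hab⟩ : ∃ a, a ≠ i ∧ ∃ b, b ≠ i ∧ a ≠ b := by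
      have : 1 < ({i}ᶜ : Finset (Fin (N + 1))).card := by
        rw [Finset.card_compl, Fintype.card_fin, Finset.card_singleton]; omega
      obtain ⟨a, ha, b, hb, hab⟩ := Finset.one_lt_card.1 this
      exact ⟨a, by simpa using ha, b, by simpa using hb, hab⟩
    refine ⟨Equiv.swap a b * Equiv.swap ρ i, ?_, ?_⟩
    · rw [map_mul, Equiv.Perm.sign_swap hab]
      rcases Int.units_eq_one_or ε with rfl | rfl <;>
        rcases Int.units_eq_one_or (Equiv.Perm.sign (Equiv.swap ρ i)) with h' | h' <;> simp_all
    · simp [Equiv.swap_apply_of_ne_of_ne ha.symm hb.symm]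

theorem exists_lt_rk_eq (hS : 2 ≤ S) (hN : 4 * S ≤ N) (x : SignedPoset S N ε) (n : ℕ)
    (hx : rk x.1 = n + 1) : ∃ y < x, rk y.1 = n := by
  have h0 : 0 / S = 0 := Nat.zero_div S
  have h1 : 1 / S = 0 := Nat.div_eq_of_lt hS
  let k0 : SignedPoset S N ε := ⟨k ⟨0, by omega⟩, hasSign_k _ _⟩
  let k1 : SignedPoset S N ε := ⟨k ⟨1, by omega⟩, hasSign_k _ _⟩
  obtain ⟨x, hxs⟩ := x
  cases x with
  | k d =>
    simp only [rk] at hx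
    rcases n with _ | _ | _ | n
    · exact ⟨k0, by simp [lt_iff_below, k0, Below, hx], by simp [k0, rk]⟩
    · exact ⟨⟨c 0 0, hasSign_c _ _ _⟩, by simp [lt_iff_below, Below, hx], rfl⟩
    · exact ⟨⟨y 0, hasSign_y _ _⟩, by simp [lt_iff_below, Below, hx], rfl⟩
    · have hSd : S ≤ d := by
        by_contra hlt
        rw [Nat.div_eq_of_lt (not_le.1 hlt)] at hx
        omega
      have hd : ((d : ℕ) - S) / S = n + 3 := by
        rw [Nat.div_eq_sub_div (by omega) hSd] at hx; omega
      refine ⟨⟨k ⟨d - S, by omega⟩, hasSign_k _ _⟩, ?_, by simpa [rk] using hd⟩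
      simp [lt_iff_below, Below, hx, hd]
  | c ρ i =>
    obtain rfl : n = 0 := by simpa [rk] using hx.symm
    by_cases hρ : ρ = 0
    · exact ⟨k1, by simp [lt_iff_below, k1, Below, h1, hρ], by simp [k1, rk, h1]⟩
    · refine ⟨k0, ?_, by simp [k0, rk]⟩
      simpa [lt_iff_below, k0, Below] using hρ
  | y ρ =>
    obtain rfl : n = 1 := by simpa [rk] using hx.symm
    obtain ⟨ρ', h⟩ : ∃ ρ', ρ' ≠ ρ := by
      have : Nontrivial (Fin (N + 1)) := Fin.nontrivial_iff_two_le.2 (by omega)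
      exact exists_ne ρ
    exact ⟨⟨c ρ' 0, hasSign_c _ _ _⟩, by simpa [lt_iff_below, Below] using h, rfl⟩
  | t π =>
    obtain rfl : n = 1 := by simpa [rk] using hx.symm
    exact ⟨⟨u, hasSign_u _⟩, by simp [lt_iff_below, Below], rfl⟩
  | u =>
    obtain rfl : n = 0 := by simpa [rk] using hx.symm
    exact ⟨k0, by simp [lt_iff_below, k0, Below], by simp [k0, rk]⟩
  | v =>
    obtain rfl : n = 0 := by simpa [rk] using hx.symm
    exact ⟨k0, by simp [lt_iff_below, k0, Below], by simp [k0, rk]⟩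

theorem height_eq (hS : 2 ≤ S) (hN : 4 * S ≤ N) (x : SignedPoset S N ε) :
    Order.height x = rk x.1 :=
  height_eq_of_strictMono_of_pred (fun x : SignedPoset S N ε => rk x.1)
    (fun _ _ h => (lt_iff.1 h).rk_lt) (exists_lt_rk_eq hS hN) x

/-- The marker `k d`. -/
def marker (ε : ℤˣ) (d : Fin N) : SignedPoset S N ε := ⟨k d, hasSign_k _ _⟩

theorem marker_injective : Function.Injective (marker ε : Fin N → SignedPoset S N ε) :=
  fun d e h => by simpa [marker] using congrArg Subtype.val h

/-- Deleting the same marker from both ordered sets gives isomorphic cards. -/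
def cardIso (d : Fin N) : Card (SignedPoset S N ε) (marker ε d) ≃o
    Card (SignedPoset S N (-ε)) (marker (-ε) d) where
  toFun p := ⟨⟨moveRows (Equiv.swap d.castSucc d.succ) p.1.1,
    p.1.2.moveRows (Equiv.Perm.sign_swap Fin.castSucc_lt_succ.ne)⟩, by
      obtain ⟨⟨p, hp⟩, hpd⟩ := p
      have hpd' : p ≠ k d := fun h => hpd (Subtype.ext h)
      cases p <;> simp_all [marker, moveRows]⟩
  invFun p := ⟨⟨moveRows (Equiv.swap d.castSucc d.succ) p.1.1, by
    simpa using p.1.2.moveRows (Equiv.Perm.sign_swap (Fin.castSucc_lt_succ (i := d)).ne)⟩, by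
      obtain ⟨⟨p, hp⟩, hpd⟩ := p
      have hpd' : p ≠ k d := fun h => hpd (Subtype.ext h)
      cases p <;> simp_all [marker, moveRows]⟩
  left_inv p := by
    ext
    exact moveRows_moveRows _ _ (Equiv.swap_mul_self _ _) _
  right_inv p := by
    ext
    exact moveRows_moveRows _ _ (Equiv.swap_mul_self _ _) _
  map_rel_iff' := by
    rintro ⟨⟨p, hp⟩, hpd⟩ ⟨⟨q, hq⟩, hqd⟩
    have hpd' : p ≠ k d := fun h => hpd (Subtype.ext h)
    have hqd' : q ≠ k d := fun h => hqd (Subtype.ext h)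
    have hinj : Function.Injective (moveRows (S := S) (Equiv.swap d.castSucc d.succ)) :=
      Function.LeftInverse.injective (moveRows_moveRows _ _ (Equiv.swap_mul_self _ _))
    simp only [Equiv.coe_fn_mk, Subtype.mk_le_mk, le_def, moveRows_below hpd' hqd', hinj.eq_iff]

theorem equalMarkedRankDecks (hS : 2 ≤ S) (hN : 4 * S ≤ N) {r : ℕ} (h1 : r ≠ 1) (h2 : r ≠ 2) :
    EqualMarkedRankDecks (SignedPoset S N ε) (SignedPoset S N (-ε)) r := by
  have key : ∀ {ε : ℤˣ} (x : {x : SignedPoset S N ε // Order.height x = (r : ℕ∞)}),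
      ∃ d : Fin N, x.1 = marker ε d ∧ (d : ℕ) / S = r := by
    rintro ε ⟨⟨x, hs⟩, hx⟩
    rw [height_eq hS hN, Nat.cast_inj] at hx
    cases x with
    | k d => exact ⟨d, rfl, hx⟩
    | _ => simp only [rk] at hx; omega
  choose f hf hfr using @key
  have hmk : ∀ {ε : ℤˣ} {d : Fin N}, (d : ℕ) / S = r →
      Order.height (marker ε d : SignedPoset S N ε) = (r : ℕ∞) := fun {ε d} hd => by
    rw [height_eq hS hN, Nat.cast_inj]; exact hd
  have hfm : ∀ {ε : ℤˣ} {d : Fin N} (h), f (ε := ε) ⟨marker ε d, h⟩ = d := fun {ε d} h =>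
    marker_injective (hf (ε := ε) ⟨marker ε d, h⟩).symm
  refine ⟨⟨fun x => ⟨marker (-ε) (f x), hmk (hfr x)⟩, fun x => ⟨marker ε (f x), hmk (hfr x)⟩,
    fun x => ?_, fun x => ?_⟩, fun x => ?_⟩
  · apply Subtype.ext; simp only [hfm]; exact (hf x).symm
  · apply Subtype.ext; simp only [hfm]; exact (hf x).symm
  · obtain ⟨d, hd⟩ : ∃ d, x.1 = marker ε d := ⟨_, hf x⟩
    obtain ⟨x, hx⟩ := x
    subst hd
    have iso : ∀ e, e = d → ∃ Φ : Card (SignedPoset S N ε) (marker ε d) ≃o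
        Card (SignedPoset S N (-ε)) (marker (-ε) e),
        ∀ z, Order.height (Φ z).val = Order.height z.val := by
      rintro _ rfl
      refine ⟨cardIso _, fun z => ?_⟩
      rw [height_eq hS hN, height_eq hS hN]
      exact congrArg _ (rk_moveRows _ _)
    exact iso _ (hfm hx)

/-- The point `u`. -/
def uPt (ε : ℤˣ) : SignedPoset S N ε := ⟨u, hasSign_u _⟩

/-- The point `v`. -/
def vPt (ε : ℤˣ) : SignedPoset S N ε := ⟨v, hasSign_v _⟩

/-- The grid point `c ρ i`. -/
def gridPt (ε : ℤˣ) (ρ i : Fin (N + 1)) : SignedPoset S N ε := ⟨c ρ i, hasSign_c _ _ _⟩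

/-- The row `y ρ`. -/
def rowPt (ε : ℤˣ) (ρ : Fin (N + 1)) : SignedPoset S N ε := ⟨y ρ, hasSign_y _ _⟩

/-- The state `t π`. -/
def statePt (π : Equiv.Perm (Fin (N + 1))) (h : Equiv.Perm.sign π = ε) : SignedPoset S N ε :=
  ⟨t π, hasSign_t.2 h⟩

theorem uPt_lt_iff {p : SignedPoset S N ε} : uPt ε < p ↔ ∃ π h, p = statePt π h := by
  obtain ⟨p, hp⟩ := p
  cases p with
  | t π => simpa [lt_iff_below, uPt, Below, statePt] using hp
  | _ => simp [lt_iff_below, uPt, Below, statePt]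

theorem eq_rowPt_iff {p : SignedPoset S N ε} :
    (∃ ρ, p = rowPt ε ρ) ↔ rk p.1 = 2 ∧ ¬ vPt ε < p := by
  obtain ⟨p, hp⟩ := p
  cases p <;> simp [lt_iff_below, vPt, Below, rowPt, rk]

theorem eq_gridPt_iff (hN : 2 ≤ N) {p : SignedPoset S N ε} : (∃ ρ i, p = gridPt ε ρ i) ↔
    rk p.1 = 1 ∧ p ≠ uPt ε ∧ p ≠ vPt ε ∧ ∃ q, uPt ε < q ∧ p < q := by
  obtain ⟨p, hp⟩ := p
  cases p with
  | c ρ i =>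
    obtain ⟨π, hπ, h⟩ := exists_perm_apply_eq hN ε ρ i
    have : ∃ q, uPt ε < q ∧ (⟨c ρ i, hp⟩ : SignedPoset S N ε) < q :=
      ⟨statePt π hπ, uPt_lt_iff.2 ⟨_, _, rfl⟩, lt_iff.2 h.ge⟩
    exact ⟨fun _ => ⟨rfl, by simp [uPt], by simp [vPt], this⟩, fun _ => ⟨ρ, i, rfl⟩⟩
  | k d =>
    have : ∀ q, uPt ε < q → (⟨k d, hp⟩ : SignedPoset S N ε) < q → (d : ℕ) / S ≠ 1 := by
      rintro q hq h hd
      obtain ⟨π, h', rfl⟩ := uPt_lt_iff.1 hq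
      simp [lt_iff_below, statePt, Below, hd] at h
    simp only [gridPt, Subtype.mk.injEq, reduceCtorEq, exists_false, rk, false_iff]
    rintro ⟨h1, -, -, q, h2, h3⟩
    exact this q h2 h3 h1
  | _ => simp [gridPt, rk, uPt, vPt]

theorem eq_uPt_or_vPt_iff (hS : 2 ≤ S) (hN : 4 * S ≤ N) {p : SignedPoset S N ε} :
    p = uPt ε ∨ p = vPt ε ↔ rk p.1 = 1 ∧ ∀ q, p < q → rk q.1 ≠ 3 := by
  have hS' : 3 * S / S = 3 := Nat.mul_div_cancel _ (by omega)
  obtain ⟨p, hp⟩ := p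
  cases p with
  | c ρ i =>
    simp only [uPt, vPt, Subtype.mk.injEq, reduceCtorEq, or_self, false_iff, not_and, not_forall]
    exact fun _ => ⟨marker ε ⟨3 * S, by omega⟩, by simp [lt_iff_below, marker, Below, hS'],
      by simp [marker, rk, hS']⟩
  | k d =>
    simp only [uPt, vPt, Subtype.mk.injEq, reduceCtorEq, or_self, false_iff, not_and, not_forall]
    intro hd
    simp only [rk] at hd
    exact ⟨marker ε ⟨3 * S, by omega⟩, by simp [lt_iff_below, marker, Below, hS', hd],
      by simp [marker, rk, hS']⟩
  | u =>
    simp only [uPt, true_or, rk, true_iff, true_and]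
    rintro ⟨q, hq⟩ h
    cases q <;> simp_all [lt_iff_below, Below]
  | v =>
    simp only [vPt, or_true, rk, true_iff, true_and]
    rintro ⟨q, hq⟩ h
    cases q <;> simp_all [lt_iff_below, Below]
  | _ => simp [rk, uPt, vPt]

theorem eq_marker_iff {p : SignedPoset S N ε} : (∃ d, p = marker ε d) ↔
    ¬ (∃ ρ i, p = gridPt ε ρ i) ∧ ¬ (∃ ρ, p = rowPt ε ρ) ∧ ¬ (∃ π h, p = statePt π h) ∧
      p ≠ uPt ε ∧ p ≠ vPt ε := by
  obtain ⟨p, hp⟩ := p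
  cases p with
  | t π => simpa [marker, gridPt, rowPt, statePt, uPt, vPt] using hp
  | _ => simp [marker, gridPt, rowPt, statePt, uPt, vPt]

section Iso

variable {ε' : ℤˣ} (hS : 2 ≤ S) (hN : 4 * S ≤ N)
  (Φ : SignedPoset S N ε ≃o SignedPoset S N ε')

include hS hN

theorem rk_map (p : SignedPoset S N ε) : rk (Φ p).1 = rk p.1 := by
  have := Order.height_orderIso Φ p
  rwa [height_eq hS hN, height_eq hS hN, Nat.cast_inj] at this

theorem map_uPt_or (p : SignedPoset S N ε) :
    Φ p = uPt ε' ∨ Φ p = vPt ε' ↔ p = uPt ε ∨ p = vPt ε := by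
  rw [eq_uPt_or_vPt_iff hS hN, eq_uPt_or_vPt_iff hS hN, rk_map hS hN, Φ.surjective.forall]
  simp only [rk_map hS hN, Φ.lt_iff_lt]

theorem map_uPt : Φ (uPt ε) = uPt ε' := by
  refine ((map_uPt_or hS hN Φ _).2 (Or.inl rfl)).resolve_right fun h => ?_
  have hv : Φ (vPt ε) = uPt ε' := by
    refine ((map_uPt_or hS hN Φ _).2 (Or.inr rfl)).resolve_right fun h' => ?_
    have := Φ.injective (h.trans h'.symm)
    simp [uPt, vPt] at this
  let q : SignedPoset S N ε := marker ε ⟨2 * S, by omega⟩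
  have hq : vPt ε < q := by
    simp [q, lt_iff_below, vPt, marker, Below, Nat.mul_div_cancel _ (show 0 < S by omega)]
  rw [← Φ.lt_iff_lt, hv] at hq
  obtain ⟨π, hπ, h'⟩ := uPt_lt_iff.1 hq
  have : uPt ε < q := by
    rw [← Φ.lt_iff_lt, h, h']
    simp [lt_iff_below, vPt, statePt, Below]
  simp [q, lt_iff_below, uPt, marker, Below] at this

theorem map_vPt : Φ (vPt ε) = vPt ε' := by
  refine ((map_uPt_or hS hN Φ _).2 (Or.inr rfl)).resolve_left fun h => ?_
  have := Φ.injective (h.trans (map_uPt hS hN Φ).symm)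
  simp [uPt, vPt] at this

theorem map_state (p : SignedPoset S N ε) :
    (∃ π h, Φ p = statePt π h) ↔ ∃ π h, p = statePt π h := by
  rw [← uPt_lt_iff, ← uPt_lt_iff, ← map_uPt hS hN Φ, Φ.lt_iff_lt]

theorem map_row (p : SignedPoset S N ε) : (∃ ρ, Φ p = rowPt ε' ρ) ↔ ∃ ρ, p = rowPt ε ρ := by
  rw [eq_rowPt_iff, eq_rowPt_iff, ← map_vPt hS hN Φ, Φ.lt_iff_lt, rk_map hS hN]

theorem map_grid (p : SignedPoset S N ε) :
    (∃ ρ i, Φ p = gridPt ε' ρ i) ↔ ∃ ρ i, p = gridPt ε ρ i := by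
  rw [eq_gridPt_iff (by omega), eq_gridPt_iff (by omega), ← map_vPt hS hN Φ,
    ← map_uPt hS hN Φ, rk_map hS hN, Φ.surjective.exists]
  simp only [Φ.lt_iff_lt, ne_eq, Φ.injective.eq_iff]

theorem map_marker (p : SignedPoset S N ε) :
    (∃ d, Φ p = marker ε' d) ↔ ∃ d, p = marker ε d := by
  rw [eq_marker_iff, eq_marker_iff, map_grid hS hN, map_row hS hN, map_state hS hN,
    ← map_vPt hS hN Φ, ← map_uPt hS hN Φ]
  simp only [ne_eq, Φ.injective.eq_iff]

theorem exists_map_marker_eq (d : Fin N) : ∃ e : Fin N, Φ (marker ε e) = marker ε' d ∧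
    (e : ℕ) / S = d / S ∧ ((e : ℕ) = 0 ↔ (d : ℕ) = 0) := by
  obtain ⟨p, hp⟩ := Φ.surjective (marker ε' d)
  obtain ⟨e, rfl⟩ := (map_marker hS hN Φ p).1 ⟨d, hp⟩
  refine ⟨e, hp, ?_, ?_⟩
  · have := rk_map hS hN Φ (marker ε e)
    rw [hp] at this
    exact this.symm
  · have := Φ.lt_iff_lt (x := marker ε e) (y := uPt ε)
    rw [hp, map_uPt hS hN] at this
    simpa [lt_iff_below, marker, uPt, Below] using this.symm

theorem map_rowPt (ρ : Fin (N + 1)) : Φ (rowPt ε ρ) = rowPt ε' ρ := by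
  choose r hr using fun ρ => (map_row hS hN Φ (rowPt ε ρ)).2 ⟨ρ, rfl⟩
  choose a b hab using fun ρ i => (map_grid hS hN Φ (gridPt ε ρ i)).2 ⟨ρ, i, rfl⟩
  have ha (ρ i) : a ρ i = r ρ := by
    have := Φ.lt_iff_lt (x := gridPt ε ρ i) (y := rowPt ε ρ)
    rw [hab, hr] at this
    simpa [lt_iff_below, gridPt, rowPt, Below] using this
  have hrinj : Function.Injective r := fun ρ ρ' h => by
    have := Φ.injective ((hr ρ).trans ((congrArg _ h).trans (hr ρ').symm))
    simpa [rowPt] using this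
  have hmono : Monotone r := fun ρ ρ' hρ => by
    by_contra! hlt
    obtain ⟨e, he, hed, he0⟩ := exists_map_marker_eq hS hN Φ ⟨r ρ', by omega⟩
    dsimp only at hed he0
    have key (σ : Fin (N + 1)) : (σ : ℕ) ≤ e ↔ (r σ : ℕ) ≤ r ρ' := by
      have hrow := Φ.lt_iff_lt (x := marker ε e) (y := rowPt ε σ)
      have hrow' := Φ.lt_iff_lt (x := rowPt ε σ) (y := marker ε e)
      have hgrid := Φ.lt_iff_lt (x := marker ε e) (y := gridPt ε σ 0)
      have hgrid' := Φ.lt_iff_lt (x := gridPt ε σ 0) (y := marker ε e)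
      rw [he, hr] at hrow hrow'
      rw [he, hab, ha] at hgrid hgrid'
      simp only [lt_iff_below, ← Subtype.coe_lt_coe, marker, rowPt, gridPt, Below]
        at hrow hrow' hgrid hgrid'
      rw [hed] at hrow hrow' hgrid hgrid'
      generalize ((r ρ' : ℕ) / S) = x at *
      omega
    have h1 := (key ρ').2 le_rfl
    have h2 := (key ρ).1 (le_trans hρ h1)
    omega
  rw [hr, Fin.eq_id_of_monotone_of_injective hmono hrinj, id]

theorem map_gridPt (ρ i : Fin (N + 1)) : Φ (gridPt ε ρ i) = gridPt ε' ρ i := by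
  have hcol (i) : ∃ j, Φ (gridPt ε ρ i) = gridPt ε' ρ j := by
    obtain ⟨ρ', j, h⟩ := (map_grid hS hN Φ (gridPt ε ρ i)).2 ⟨ρ, i, rfl⟩
    have := Φ.lt_iff_lt (x := gridPt ε ρ i) (y := rowPt ε ρ)
    rw [h, map_rowPt hS hN] at this
    obtain rfl : ρ' = ρ := by
      simpa [lt_iff_below, gridPt, rowPt, Below] using this
    exact ⟨j, h⟩
  choose f hf using hcol
  have hfinj : Function.Injective f := fun i j h => by
    have := Φ.injective ((hf i).trans ((congrArg _ h).trans (hf j).symm))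
    simpa [gridPt] using this
  have hmono : Monotone f := fun i j hij => by
    obtain ⟨π, hπ, hj⟩ := exists_perm_apply_eq (by omega) ε' ρ (f j)
    obtain ⟨p, hp⟩ := Φ.surjective (statePt π hπ)
    obtain ⟨π', hπ', rfl⟩ := (map_state hS hN Φ p).1 ⟨π, hπ, hp⟩
    have key (l) : f l ≤ f j ↔ l ≤ π' ρ := by
      have := Φ.lt_iff_lt (x := gridPt ε ρ l) (y := statePt π' hπ')
      rw [hf, hp] at this
      simpa [lt_iff_below, gridPt, statePt, Below, hj] using this
    exact (key i).2 (hij.trans ((key j).1 le_rfl))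
  rw [hf, Fin.eq_id_of_monotone_of_injective hmono hfinj, id]

end Iso

theorem isEmpty_orderIso (hS : 2 ≤ S) (hN : 4 * S ≤ N) :
    IsEmpty (SignedPoset S N 1 ≃o SignedPoset S N (-1)) := by
  refine ⟨fun Φ => ?_⟩
  have h1 : Equiv.Perm.sign (1 : Equiv.Perm (Fin (N + 1))) = 1 := map_one _
  obtain ⟨π, hπ, h⟩ := (map_state hS hN Φ (statePt 1 h1)).2 ⟨1, h1, rfl⟩
  have key (ρ i) : i ≤ π ρ ↔ i ≤ ρ := by
    have := Φ.lt_iff_lt (x := gridPt 1 ρ i) (y := statePt 1 h1)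
    rw [map_gridPt hS hN, h] at this
    simpa [lt_iff_below, gridPt, statePt, Below] using this
  obtain rfl : π = 1 := Equiv.ext fun ρ =>
    le_antisymm ((key ρ _).1 le_rfl) ((key ρ _).2 le_rfl)
  rw [h1] at hπ
  exact absurd hπ (by decide)

theorem height_marker (hS : 2 ≤ S) (hN : 4 * S ≤ N) (d : Fin N) :
    Order.height (marker ε d : SignedPoset S N ε) = ((d / S : ℕ) : ℕ∞) :=
  height_eq hS hN _

/-- The first `s` markers of rank `n`. -/
def markerOfRank (ε : ℤˣ) {s m : ℕ} (hs : s ≤ S) (hN : m * S ≤ N) {n : ℕ} (hn : n < m)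
    (i : Fin s) : SignedPoset S N ε :=
  marker ε ⟨n * S + i, by
    have := Nat.mul_le_mul_right S (Nat.succ_le_of_lt hn)
    rw [Nat.succ_mul] at this
    omega⟩

theorem markerOfRank_injective {s m : ℕ} (hs : s ≤ S) (hN : m * S ≤ N) {n : ℕ} (hn : n < m) :
    Function.Injective (markerOfRank ε hs hN hn) := fun i j h => by
  simpa [Fin.ext_iff] using marker_injective h

theorem height_markerOfRank (hS : 2 ≤ S) (hN4 : 4 * S ≤ N) {s m : ℕ} (hs : s ≤ S)
    (hN : m * S ≤ N) {n : ℕ} (hn : n < m) (i : Fin s) :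
    Order.height (markerOfRank ε hs hN hn i) = (n : ℕ∞) := by
  rw [markerOfRank, height_marker hS hN4, Nat.cast_inj]
  exact Nat.div_eq_of_lt_le (by simp) (by simp only [Nat.succ_mul]; omega)

theorem le_card_rank (hS : 2 ≤ S) {s m : ℕ} (hs : s ≤ S) (hm : 4 ≤ m) (n : ℕ)
    (h : ∃ x : SignedPoset S (m * S) ε, Order.height x = (n : ℕ∞)) :
    s ≤ Nat.card {x : SignedPoset S (m * S) ε // Order.height x = (n : ℕ∞)} := by
  have hN4 : 4 * S ≤ m * S := Nat.mul_le_mul_right S hm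
  have hn : n < m := by
    obtain ⟨⟨p, hp⟩, hx⟩ := h
    rw [height_eq hS hN4, Nat.cast_inj] at hx
    cases p with
    | k d => exact hx ▸ Nat.div_lt_of_lt_mul (d.2.trans_eq (mul_comm m S))
    | _ => simp only [rk] at hx; omega
  have := Nat.card_le_card_of_injective
    (fun i => (⟨_, height_markerOfRank hS hN4 hs le_rfl hn i⟩ :
      {x : SignedPoset S (m * S) ε // Order.height x = (n : ℕ∞)}))
    fun i j h => markerOfRank_injective hs le_rfl hn (congrArg Subtype.val h)
  simpa using this

theorem le_posetHeight (hS : 2 ≤ S) {m : ℕ} (hm : 4 ≤ m) {n : ℕ} (hn : n < m) :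
    (n : ℕ∞) ≤ posetHeight (SignedPoset S (m * S) ε) := by
  rw [← height_markerOfRank (ε := ε) hS (Nat.mul_le_mul_right S hm) (s := 1) (by omega)
    le_rfl hn 0]
  exact le_iSup (fun x : SignedPoset S (m * S) ε => Order.height x) _

/-- `SignedPoset` as a `FinPoset`. -/
noncomputable def toFinPoset (S N : ℕ) (ε : ℤˣ) : FinPoset where
  carrier := SignedPoset S N ε
  ft := Fintype.ofFinite _

end SignedPoset

/--
For every `h` and `s` there exist finite ordered sets `P1` and `P2` such that: `P1` and
`P2` are not order-isomorphic; both have height at least `h`; for every rank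
`k ∉ {1, 2}` they have equal marked rank `k` decks; every occurring rank of `P1` and of
`P2` contains at least `s` elements; and even for each of the ranks `1` and `2` there
are at least `s` elements of that rank in `P1`, with correspondingly many elements of
that rank in `P2`, whose removal produces order-isomorphic cards.
-/
theorem exists_pairs_all_ranks_but_one_and_two (h s : ℕ) :
    ∃ P1 P2 : FinPoset,
      IsEmpty (↥P1 ≃o ↥P2) ∧
      (h : ℕ∞) ≤ posetHeight ↥P1 ∧ (h : ℕ∞) ≤ posetHeight ↥P2 ∧
      (∀ k : ℕ, k ≠ 1 → k ≠ 2 → EqualMarkedRankDecks ↥P1 ↥P2 k) ∧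
      (∀ k : ℕ, (∃ x : ↥P1, Order.height x = (k : ℕ∞)) →
        s ≤ Nat.card {x : ↥P1 // Order.height x = (k : ℕ∞)}) ∧
      (∀ k : ℕ, (∃ x : ↥P2, Order.height x = (k : ℕ∞)) →
        s ≤ Nat.card {x : ↥P2 // Order.height x = (k : ℕ∞)}) ∧
      (∀ k : ℕ, k = 1 ∨ k = 2 →
        ∃ (f : Fin s → ↥P1) (g : Fin s → ↥P2),
          Function.Injective f ∧ Function.Injective g ∧
          ∀ i : Fin s, Order.height (f i) = (k : ℕ∞) ∧ Order.height (g i) = (k : ℕ∞) ∧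
            Nonempty (Card ↥P1 (f i) ≃o Card ↥P2 (g i))) := by
  have hS : 2 ≤ s + 2 := by omega
  have hs : s ≤ s + 2 := by omega
  have hm : 4 ≤ h + 4 := by omega
  have hN := Nat.mul_le_mul_right (s + 2) hm
  refine ⟨SignedPoset.toFinPoset (s + 2) ((h + 4) * (s + 2)) 1,
    SignedPoset.toFinPoset (s + 2) ((h + 4) * (s + 2)) (-1),
    SignedPoset.isEmpty_orderIso hS hN, SignedPoset.le_posetHeight hS hm (by omega),
    SignedPoset.le_posetHeight hS hm (by omega),
    fun k h1 h2 => SignedPoset.equalMarkedRankDecks hS hN h1 h2,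
    SignedPoset.le_card_rank hS hs hm, SignedPoset.le_card_rank hS hs hm, fun k hk => ?_⟩
  have hk : k < h + 4 := by omega
  exact ⟨SignedPoset.markerOfRank 1 hs le_rfl hk, SignedPoset.markerOfRank (-1) hs le_rfl hk,
    SignedPoset.markerOfRank_injective hs le_rfl hk,
    SignedPoset.markerOfRank_injective hs le_rfl hk, fun i =>
    ⟨SignedPoset.height_markerOfRank hS hN hs le_rfl hk i,
      SignedPoset.height_markerOfRank hS hN hs le_rfl hk i, ⟨SignedPoset.cardIso _⟩⟩⟩
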